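/- arXiv:2508.01341 — 2 statements merged into one kernel-verified Lean document; each statement's English description precedes it below -/
import Mathlib

section
/- Let (Ω, P) be a probability space, let Y(0), Y(1) be integrable real-valued random variables (the potential outcomes), and let A : Ω → {0,1} be a random variable with 0 < P(A=1) < 1 that is independent of the pair (Y(0), Y(1)). Define the observed outcome Y = A·Y(1) + (1−A)·Y(0) and the true average treatment effect τ = E[Y(1)] − E[Y(0)]. Suppose Ŷ = k·Y + m + e for constants k, m ∈ ℝ, where e is an integrable random variable with E[e·1{A=a}] = 0 for a ∈ {0,1}. Then the treatment-effect estimand computed from predictions, τ̂ = E[Ŷ·1{A=1}]/P(A=1) − E[Ŷ·1{A=0}]/P(A=0), satisfies τ̂ = k·τ; in particular it is attenuated toward 0 whenever 0 < k < 1. -/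
open MeasureTheory ProbabilityTheory

theorem setInt_aux {Ω : Type*} [MeasurableSpace Ω] (P : Measure Ω) [IsProbabilityMeasure P]
    (Y A : Ω → ℝ) (hY : Integrable Y P) (hA : Measurable A) (hi : IndepFun A Y P) (a : ℝ) :
    ∫ ω in {ω | A ω = a}, Y ω ∂P = (P {ω | A ω = a}).toReal * ∫ ω, Y ω ∂P := by
  have hm : MeasurableSet {ω | A ω = a} := hA (measurableSet_singleton a)
  have hg : Measurable (Set.indicator ({a} : Set ℝ) (fun _ => (1 : ℝ))) :=
    measurable_const.indicator (measurableSet_singleton a)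
  have h1 := (hi.comp hg measurable_id).integral_fun_mul_eq_mul_integral
    (hg.comp hA).aestronglyMeasurable hY.aestronglyMeasurable
  have e1 : (Set.indicator ({a} : Set ℝ) (fun _ => (1 : ℝ))) ∘ A
      = Set.indicator {ω | A ω = a} (fun _ => (1 : ℝ)) := by
    ext ω
    by_cases h : A ω = a <;> simp [h]
  rw [e1, integral_indicator hm] at h1
  rw [← integral_indicator hm]
  have e2 : ∀ ω, Set.indicator {ω | A ω = a} Y ω
      = Set.indicator {ω | A ω = a} (fun _ => (1 : ℝ)) ω * (id ∘ Y) ω := by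
    intro ω
    by_cases h : A ω = a <;> simp [Set.indicator, h]
  simp_rw [e2]
  rw [h1]
  simp [Measure.real]

theorem setInt_aux2 {Ω : Type*} [MeasurableSpace Ω] (P : Measure Ω) [IsProbabilityMeasure P]
    (Y A e Yhat : Ω → ℝ) (k m : ℝ) (hY : Integrable Y P) (he : Integrable e P)
    (hA : Measurable A) (hi : IndepFun A Y P) (a : ℝ) (hp : P {ω | A ω = a} ≠ 0)
    (h : ∀ ω, A ω = a → Yhat ω = k * Y ω + m + e ω)
    (he0 : ∫ ω in {ω | A ω = a}, e ω ∂P = 0) :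
    (∫ ω in {ω | A ω = a}, Yhat ω ∂P) / (P {ω | A ω = a}).toReal = k * (∫ ω, Y ω ∂P) + m := by
  have hm : MeasurableSet {ω | A ω = a} := hA (measurableSet_singleton a)
  have hp' : (P {ω | A ω = a}).toReal ≠ 0 := ENNReal.toReal_ne_zero.2 ⟨hp, measure_ne_top _ _⟩
  rw [setIntegral_congr_fun hm (g := fun ω => k * Y ω + m + e ω) (fun ω hω => h ω hω),
    integral_add (f := fun ω => k * Y ω + m)
      (((hY.const_mul k).add (integrable_const m)).integrableOn) he.integrableOn,
    integral_add (hY.const_mul k).integrableOn (integrable_const m).integrableOn,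
    integral_const_mul, setInt_aux P Y A hY hA hi a, he0]
  simp only [integral_const, Measure.restrict_apply_univ, smul_eq_mul, Measure.real]
  field_simp
  ring

/-- **Proposition 1 (attenuation bias), potential-outcomes form.**
With randomly assigned binary treatment `A` independent of the potential outcomes
`(Y(0), Y(1))`, observed outcome `Y = A·Y(1) + (1−A)·Y(0)`, and predictions
`Ŷ = k·Y + m + e`, the prediction-based treatment-effect estimand equals `k·τ`,
and is attenuated toward `0` whenever `0 < k < 1`. -/
theorem attenuation_bias_potential_outcomes
    {Ω : Type*} [MeasurableSpace Ω] (P : Measure Ω) [IsProbabilityMeasure P]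
    (Y0 Y1 e Yhat A : Ω → ℝ) (k m : ℝ)
    (hY0 : Integrable Y0 P) (hY1 : Integrable Y1 P) (he : Integrable e P)
    (hA : Measurable A) (hA01 : ∀ ω, A ω = 0 ∨ A ω = 1)
    (hA1pos : 0 < P {ω | A ω = 1}) (hA1lt : P {ω | A ω = 1} < 1)
    (hindep : IndepFun A (fun ω => (Y0 ω, Y1 ω)) P)
    (hmodel : ∀ ω,
      Yhat ω = k * (A ω * Y1 ω + (1 - A ω) * Y0 ω) + m + e ω)
    (he0 : ∀ a ∈ ({0, 1} : Set ℝ), ∫ ω in {ω | A ω = a}, e ω ∂P = 0) :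
    (∫ ω in {ω | A ω = 1}, Yhat ω ∂P) / (P {ω | A ω = 1}).toReal
        - (∫ ω in {ω | A ω = 0}, Yhat ω ∂P) / (P {ω | A ω = 0}).toReal
      = k * ((∫ ω, Y1 ω ∂P) - ∫ ω, Y0 ω ∂P)
    ∧ (0 < k → k < 1 → (∫ ω, Y1 ω ∂P) - ∫ ω, Y0 ω ∂P ≠ 0 →
        |(∫ ω in {ω | A ω = 1}, Yhat ω ∂P) / (P {ω | A ω = 1}).toReal
          - (∫ ω in {ω | A ω = 0}, Yhat ω ∂P) / (P {ω | A ω = 0}).toReal|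
        < |(∫ ω, Y1 ω ∂P) - ∫ ω, Y0 ω ∂P|) := by
  have hp0 : P {ω | A ω = 0} ≠ 0 := by
    intro h0
    have hu : (Set.univ : Set Ω) ⊆ {ω | A ω = 0} ∪ {ω | A ω = 1} := fun ω _ => hA01 ω
    have h2 := (measure_mono hu).trans (measure_union_le (μ := P) _ _)
    rw [h0, zero_add, measure_univ] at h2
    exact absurd hA1lt (not_lt.2 h2)
  have key : (∫ ω in {ω | A ω = 1}, Yhat ω ∂P) / (P {ω | A ω = 1}).toReal
        - (∫ ω in {ω | A ω = 0}, Yhat ω ∂P) / (P {ω | A ω = 0}).toReal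
      = k * ((∫ ω, Y1 ω ∂P) - ∫ ω, Y0 ω ∂P) := by
    rw [setInt_aux2 P Y1 A e Yhat k m hY1 he hA (hindep.comp measurable_id measurable_snd) 1
        hA1pos.ne' (fun ω h => by rw [hmodel, h]; ring) (he0 1 (by simp)),
      setInt_aux2 P Y0 A e Yhat k m hY0 he hA (hindep.comp measurable_id measurable_fst) 0
        hp0 (fun ω h => by rw [hmodel, h]; ring) (he0 0 (by simp))]
    ring
  refine ⟨key, fun hk hk1 hne => ?_⟩
  rw [key, abs_mul, abs_of_pos hk]
  exact mul_lt_of_lt_one_left (abs_pos.2 hne) hk1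
end

section
/- Let Y be an integrable real-valued random variable with law μ on ℝ, and let ε ~ N(0, σ²), σ > 0, be independent of Y. Set Ŷ = Y − ε and let p denote the (everywhere positive, smooth) density of Ŷ. Then Tweedie's formula holds: the conditional expectation of Y given the σ-algebra generated by Ŷ satisfies, almost surely, E[Y | Ŷ] = Ŷ + σ²·p′(Ŷ)/p(Ŷ); equivalently, E[Y | Ŷ = ŷ] = ŷ + σ²·(d/dŷ) log p(ŷ). -/
open MeasureTheory ProbabilityTheory

/-- The Gaussian-smoothed density of `Ŷ = Y − ε`: `p(ŷ) = ∫ φ_σ(ŷ − y) dμ(y)`,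
where `μ` is the law of `Y` and `φ_σ` is the `N(0, σ²)` density. -/
noncomputable def smoothedDensity (μ : Measure ℝ) (σ : ℝ) (t : ℝ) : ℝ :=
  ∫ y, gaussianPDFReal 0 (Real.toNNReal (σ ^ 2)) (t - y) ∂μ

open scoped NNReal in
lemma tw_gauss_hasDerivAt (v : ℝ≥0) (u : ℝ) :
    HasDerivAt (gaussianPDFReal 0 v) (-(u / v) * gaussianPDFReal 0 v u) u := by
  have h1 : HasDerivAt (fun x : ℝ => -(x - 0) ^ 2 / (2 * (v : ℝ))) (-(u / v)) u := by
    have := ((((hasDerivAt_id u).sub_const 0).pow 2).neg).div_const (2 * (v : ℝ))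
    refine this.congr_deriv ?_
    simp
    rw [neg_div, mul_div_mul_left _ _ (two_ne_zero)]
  have h2 := (h1.exp).const_mul ((√(2 * Real.pi * v))⁻¹)
  rw [gaussianPDFReal_def]
  refine h2.congr_deriv ?_
  ring

open scoped NNReal in
lemma tw_gauss_le (v : ℝ≥0) (u : ℝ) :
    gaussianPDFReal 0 v u ≤ (√(2 * Real.pi * v))⁻¹ := by
  rw [gaussianPDFReal_def]
  have : Real.exp (-(u - 0) ^ 2 / (2 * (v : ℝ))) ≤ 1 := by
    rw [Real.exp_le_one_iff]
    apply div_nonpos_of_nonpos_of_nonneg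
    · nlinarith [sq_nonneg (u - 0)]
    · positivity
  exact mul_le_of_le_one_right (by positivity) this

open scoped NNReal in
lemma tw_gauss_mul_le (v : ℝ≥0) (hv : v ≠ 0) (u : ℝ) :
    |u| * gaussianPDFReal 0 v u ≤ (√(2 * Real.pi * v))⁻¹ * (v + 1) := by
  have hv' : (0 : ℝ) < v := by positivity
  rw [gaussianPDFReal_def]
  have h1 : |u| * Real.exp (-(u - 0) ^ 2 / (2 * (v : ℝ))) ≤ v + 1 := by
    have h2 := Real.add_one_le_exp (u ^ 2 / (2 * (v : ℝ)))
    have h3 : -(u - 0) ^ 2 / (2 * (v : ℝ)) = -(u ^ 2 / (2 * (v : ℝ))) := by ring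
    rw [h3, Real.exp_neg, ← div_eq_mul_inv, div_le_iff₀ (Real.exp_pos _)]
    have h4 : |u| ≤ (v + 1) * (u ^ 2 / (2 * (v : ℝ)) + 1) := by
      have h5 : (v + 1) * (u ^ 2 / (2 * (v : ℝ)) + 1)
          = u ^ 2 / 2 + u ^ 2 / (2 * (v : ℝ)) + v + 1 := by field_simp; ring
      have h6 : 0 ≤ u ^ 2 / (2 * (v : ℝ)) := by positivity
      rw [h5]
      nlinarith [sq_nonneg (|u| - 1), sq_abs u]
    exact h4.trans (by gcongr)
  calc _ = (√(2 * Real.pi * v))⁻¹ * (|u| * Real.exp (-(u - 0) ^ 2 / (2 * (v : ℝ)))) := by ring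
    _ ≤ _ := by gcongr

open scoped NNReal in
lemma tw_int_g (μ : Measure ℝ) [IsFiniteMeasure μ] (v : ℝ≥0) (t : ℝ) :
    Integrable (fun y => gaussianPDFReal 0 v (t - y)) μ := by
  refine Integrable.of_bound (C := (√(2 * Real.pi * v))⁻¹)
    ((measurable_gaussianPDFReal 0 v).comp (by fun_prop)).aestronglyMeasurable
    (ae_of_all _ fun y => ?_)
  rw [Real.norm_of_nonneg (gaussianPDFReal_nonneg _ _ _)]
  exact tw_gauss_le _ _

open scoped NNReal in
lemma tw_int_yg (μ : Measure ℝ) [IsFiniteMeasure μ] (hμ : Integrable (fun y : ℝ => y) μ)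
    (v : ℝ≥0) (t : ℝ) :
    Integrable (fun y => y * gaussianPDFReal 0 v (t - y)) μ := by
  refine hμ.mul_bdd (c := (√(2 * Real.pi * v))⁻¹)
    ((measurable_gaussianPDFReal 0 v).comp (by fun_prop)).aestronglyMeasurable
    (ae_of_all _ fun y => ?_)
  rw [Real.norm_of_nonneg (gaussianPDFReal_nonneg _ _ _)]
  exact tw_gauss_le _ _

open scoped NNReal in
lemma tw_deriv (μ : Measure ℝ) [IsFiniteMeasure μ] (hμ : Integrable (fun y : ℝ => y) μ)
    (v : ℝ≥0) (hv : v ≠ 0) (t : ℝ) :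
    HasDerivAt (fun t => ∫ y, gaussianPDFReal 0 v (t - y) ∂μ)
      (((∫ y, y * gaussianPDFReal 0 v (t - y) ∂μ)
        - t * ∫ y, gaussianPDFReal 0 v (t - y) ∂μ) / v) t := by
  have hv' : (0 : ℝ) < v := by positivity
  have key := (hasDerivAt_integral_of_dominated_loc_of_deriv_le (μ := μ) (x₀ := t)
    (s := Set.univ) (F := fun t y => gaussianPDFReal 0 v (t - y))
    (F' := fun t y => -((t - y) / v) * gaussianPDFReal 0 v (t - y))
    (bound := fun _ => ((√(2 * Real.pi * v))⁻¹ * (v + 1)) / v)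
    Filter.univ_mem
    (Filter.Eventually.of_forall fun x => (tw_int_g μ v x).aestronglyMeasurable)
    (tw_int_g μ v t)
    (by
      have := (measurable_gaussianPDFReal 0 v)
      apply Measurable.aestronglyMeasurable
      fun_prop)
    (ae_of_all _ fun y x _ => by
      rw [norm_mul, norm_neg, norm_div, Real.norm_of_nonneg (gaussianPDFReal_nonneg _ _ _),
        Real.norm_eq_abs, Real.norm_of_nonneg hv'.le, div_mul_eq_mul_div]
      exact div_le_div_of_nonneg_right (tw_gauss_mul_le v hv _) hv'.le)
    (integrable_const _)
    (ae_of_all _ fun y x _ => by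
      have := (tw_gauss_hasDerivAt v (x - y)).comp x ((hasDerivAt_id x).sub_const y)
      rw [mul_one] at this
      exact this)).2
  refine key.congr_deriv ?_
  rw [← integral_const_mul, ← integral_sub (tw_int_yg μ hμ v t) ((tw_int_g μ v t).const_mul t),
    ← integral_div]
  congr 1
  ext y
  ring

open scoped NNReal in
lemma tw_pos (μ : Measure ℝ) [IsProbabilityMeasure μ] (v : ℝ≥0) (hv : v ≠ 0) (t : ℝ) :
    0 < ∫ y, gaussianPDFReal 0 v (t - y) ∂μ := by
  rw [integral_pos_iff_support_of_nonneg (fun y => gaussianPDFReal_nonneg _ _ _) (tw_int_g μ v t)]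
  have : Function.support (fun y => gaussianPDFReal 0 v (t - y)) = Set.univ := by
    ext y
    simp [(gaussianPDFReal_pos 0 v (t - y) hv).ne']
  simp [this]

open scoped NNReal in
lemma tw_even (v : ℝ≥0) (u : ℝ) : gaussianPDFReal 0 v (-u) = gaussianPDFReal 0 v u := by
  simp [gaussianPDFReal_def]

def twEquiv : ℝ × ℝ ≃ᵐ ℝ × ℝ where
  toFun z := (z.1, z.1 - z.2)
  invFun z := (z.1, z.1 - z.2)
  left_inv z := by simp
  right_inv z := by simp
  measurable_toFun := by
    change Measurable (fun z : ℝ × ℝ => (z.1, z.1 - z.2))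
    fun_prop
  measurable_invFun := by
    change Measurable (fun z : ℝ × ℝ => (z.1, z.1 - z.2))
    fun_prop

lemma tw_mp (μ : Measure ℝ) [SFinite μ] :
    MeasurePreserving twEquiv (μ.prod volume) (μ.prod volume) := by
  refine (MeasurePreserving.id μ).skew_product (g := fun a c : ℝ => a - c) ?_
    (ae_of_all _ fun a => (Measure.measurePreserving_sub_left volume a).map_eq)
  change Measurable (fun z : ℝ × ℝ => z.1 - z.2)
  fun_prop

open scoped NNReal in
lemma tw_law {Ω : Type*} [MeasurableSpace Ω] (P : Measure Ω) [IsProbabilityMeasure P]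
    (Y ε : Ω → ℝ) (v : ℝ≥0) (hv : v ≠ 0) (hY : Measurable Y) (hε : Measurable ε)
    (hindep : IndepFun Y ε P) (hεlaw : P.map ε = gaussianReal 0 v)
    (F : ℝ × ℝ → ℝ) (hF : Measurable F) :
    (Integrable (fun ω => F (Y ω, Y ω - ε ω)) P ↔
      Integrable (fun z : ℝ × ℝ => gaussianPDFReal 0 v (z.2 - z.1) * F z)
        ((P.map Y).prod volume)) ∧
    ∫ ω, F (Y ω, Y ω - ε ω) ∂P =
      ∫ z : ℝ × ℝ, gaussianPDFReal 0 v (z.2 - z.1) * F z ∂((P.map Y).prod volume) := by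
  have : IsProbabilityMeasure (P.map Y) := Measure.isProbabilityMeasure_map hY.aemeasurable
  have hm : Measurable (fun z : ℝ × ℝ => gaussianPDF 0 v z.2) :=
    (measurable_gaussianPDF 0 v).comp measurable_snd
  have hpair : P.map (fun ω => (Y ω, ε ω))
      = ((P.map Y).prod volume).withDensity (fun z => gaussianPDF 0 v z.2) := by
    rw [hindep.map_prod_eq_prod_map_map hY.aemeasurable hε.aemeasurable, hεlaw,
      gaussianReal_of_var_ne_zero 0 hv, prod_withDensity_right (measurable_gaussianPDF 0 v)]
  have hFm : Measurable (fun z : ℝ × ℝ => F (z.1, z.1 - z.2)) := by fun_prop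
  have hfin : ∀ᵐ z : ℝ × ℝ ∂((P.map Y).prod volume), gaussianPDF 0 v z.2 < ⊤ :=
    ae_of_all _ fun z => gaussianPDF_lt_top
  have heq : (fun z : ℝ × ℝ => (gaussianPDF 0 v z.2).toReal • F (z.1, z.1 - z.2))
      = (fun z : ℝ × ℝ => gaussianPDFReal 0 v (z.2 - z.1) * F z) ∘ twEquiv := by
    ext z
    simp only [toReal_gaussianPDF, smul_eq_mul, Function.comp]
    change _ = gaussianPDFReal 0 v (z.1 - z.2 - z.1) * F (z.1, z.1 - z.2)
    rw [← tw_even v z.2]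
    congr 2
    ring
  constructor
  · have h1 := integrable_map_measure (μ := P) (f := fun ω => (Y ω, ε ω))
      (g := fun z : ℝ × ℝ => F (z.1, z.1 - z.2)) hFm.aestronglyMeasurable
      (hY.prodMk hε).aemeasurable
    rw [hpair, integrable_withDensity_iff_integrable_smul' hm hfin, heq,
      (tw_mp _).integrable_comp_emb twEquiv.measurableEmbedding] at h1
    exact h1.symm
  · have h1 := integral_map (μ := P) (φ := fun ω => (Y ω, ε ω)) (hY.prodMk hε).aemeasurable
      (f := fun z : ℝ × ℝ => F (z.1, z.1 - z.2)) hFm.aestronglyMeasurable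
    rw [hpair, integral_withDensity_eq_integral_toReal_smul hm hfin, heq] at h1
    rw [← h1]
    exact (MeasurePreserving.integral_comp (tw_mp (P.map Y)) twEquiv.measurableEmbedding
      (fun z : ℝ × ℝ => gaussianPDFReal 0 v (z.2 - z.1) * F z))

/-- **Tweedie's formula.** For `Ŷ = Y − ε` with `ε ~ N(0, σ²)` independent of `Y`, the
conditional expectation of `Y` given the σ-algebra generated by `Ŷ` satisfies, almost
surely, `E[Y | Ŷ] = Ŷ + σ²·p′(Ŷ)/p(Ŷ)`, where `p` is the (everywhere positive, smooth)
density of `Ŷ`. -/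
theorem tweedie_formula
    {Ω : Type*} [MeasurableSpace Ω] (P : Measure Ω) [IsProbabilityMeasure P]
    (Y ε : Ω → ℝ) (σ : ℝ) (hσ : 0 < σ)
    (hYint : Integrable Y P)
    (hY : Measurable Y) (hε : Measurable ε)
    (hindep : IndepFun Y ε P)
    (hεlaw : P.map ε = gaussianReal 0 (Real.toNNReal (σ ^ 2))) :
    ∀ᵐ ω ∂P,
      (P[Y | MeasurableSpace.comap (fun ω => Y ω - ε ω) inferInstance]) ω
        = (Y ω - ε ω)
          + σ ^ 2 * deriv (smoothedDensity (P.map Y) σ) (Y ω - ε ω)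
              / smoothedDensity (P.map Y) σ (Y ω - ε ω) := by
  set v := Real.toNNReal (σ ^ 2) with hvdef
  have hvσ : (v : ℝ) = σ ^ 2 := Real.coe_toNNReal _ (by positivity)
  have hv : v ≠ 0 := by
    intro h
    rw [h] at hvσ
    have : 0 < σ ^ 2 := by positivity
    rw [NNReal.coe_zero] at hvσ
    linarith
  have hprob : IsProbabilityMeasure (P.map Y) := Measure.isProbabilityMeasure_map hY.aemeasurable
  set μ := P.map Y with hμdef
  have hμ : Integrable (fun y : ℝ => y) μ :=
    (integrable_map_measure (g := fun y : ℝ => y) measurable_id.aestronglyMeasurable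
      hY.aemeasurable).2 hYint
  let p : ℝ → ℝ := fun t => ∫ y, gaussianPDFReal 0 v (t - y) ∂μ
  let q : ℝ → ℝ := fun t => ∫ y, y * gaussianPDFReal 0 v (t - y) ∂μ
  have hg := measurable_gaussianPDFReal 0 v
  have hpm : Measurable p := by
    have : StronglyMeasurable (Function.uncurry fun t y : ℝ => gaussianPDFReal 0 v (t - y)) := by
      apply Measurable.stronglyMeasurable
      change Measurable (fun z : ℝ × ℝ => gaussianPDFReal 0 v (z.1 - z.2))
      fun_prop
    exact this.integral_prod_right.measurable
  have hqm : Measurable q := by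
    have : StronglyMeasurable
        (Function.uncurry fun t y : ℝ => y * gaussianPDFReal 0 v (t - y)) := by
      apply Measurable.stronglyMeasurable
      change Measurable (fun z : ℝ × ℝ => z.2 * gaussianPDFReal 0 v (z.1 - z.2))
      fun_prop
    exact this.integral_prod_right.measurable
  have hp : ∀ t, 0 < p t := fun t => tw_pos μ v hv t
  let h : ℝ → ℝ := fun t => q t / p t
  have hhm : Measurable h := hqm.div hpm
  have hrhs : ∀ t, t + σ ^ 2 * deriv (smoothedDensity μ σ) t / smoothedDensity μ σ t = h t := by
    intro t
    have hd : deriv (smoothedDensity μ σ) t = (q t - t * p t) / v := (tw_deriv μ hμ v hv t).deriv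
    have hs : smoothedDensity μ σ t = p t := rfl
    rw [hd, hs, hvσ]
    have := (hp t).ne'
    have := hσ.ne'
    simp only [h]
    field_simp
    ring
  have hlaw := tw_law P Y ε v hv hY hε hindep hεlaw
  have hYg : Integrable (fun z : ℝ × ℝ => gaussianPDFReal 0 v (z.2 - z.1) * z.1)
      (μ.prod volume) := (hlaw (fun z => z.1) measurable_fst).1.1 hYint
  have hqint : Integrable q volume := by
    have := hYg.integral_prod_right
    refine this.congr (ae_of_all _ fun t => ?_)
    simp only [q, mul_comm]
  have hhg : Integrable (fun z : ℝ × ℝ => gaussianPDFReal 0 v (z.2 - z.1) * h z.2)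
      (μ.prod volume) := by
    rw [integrable_prod_iff' (by
      apply Measurable.aestronglyMeasurable
      fun_prop)]
    refine ⟨ae_of_all _ fun t => (tw_int_g μ v t).mul_const (h t), ?_⟩
    refine hqint.norm.congr (ae_of_all _ fun t => ?_)
    simp only [norm_mul, Real.norm_of_nonneg (gaussianPDFReal_nonneg _ _ _)]
    rw [integral_mul_const]
    change ‖q t‖ = p t * ‖q t / p t‖
    rw [norm_div, Real.norm_of_nonneg (hp t).le, mul_div_cancel₀ _ (hp t).ne']
  have hhint : Integrable (fun ω => h (Y ω - ε ω)) P :=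
    (hlaw (fun z => h z.2) (hhm.comp measurable_snd)).1.2 hhg
  have hYh : Measurable (fun ω => Y ω - ε ω) := hY.sub hε
  have hm : MeasurableSpace.comap (fun ω => Y ω - ε ω) inferInstance ≤ ‹MeasurableSpace Ω› :=
    hYh.comap_le
  have main : (fun ω => h (Y ω - ε ω)) =ᵐ[P]
      P[Y | MeasurableSpace.comap (fun ω => Y ω - ε ω) inferInstance] := by
    refine ae_eq_condExp_of_forall_setIntegral_eq hm hYint
      (fun s _ _ => hhint.integrableOn) ?_ ?_
    · rintro s ⟨A, hA, rfl⟩ -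
      have hA' : MeasurableSet (Prod.snd ⁻¹' A : Set (ℝ × ℝ)) := measurable_snd hA
      rw [← integral_indicator (hYh hA), ← integral_indicator (hYh hA)]
      have e1 := (hlaw ((Prod.snd ⁻¹' A).indicator fun z => h z.2)
        ((hhm.comp measurable_snd).indicator hA')).2
      have e2 := (hlaw ((Prod.snd ⁻¹' A).indicator fun z => z.1)
        (measurable_fst.indicator hA')).2
      refine Eq.trans e1 (Eq.trans ?_ e2.symm)
      have i1 := hhg.indicator hA'
      have i2 := hYg.indicator hA'
      have c : ∀ f : ℝ × ℝ → ℝ, (fun z : ℝ × ℝ => gaussianPDFReal 0 v (z.2 - z.1) *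
          (Prod.snd ⁻¹' A).indicator f z) = (Prod.snd ⁻¹' A).indicator
            (fun z : ℝ × ℝ => gaussianPDFReal 0 v (z.2 - z.1) * f z) := by
        intro f
        ext z
        by_cases hz : z ∈ Prod.snd ⁻¹' A
        · simp only [Set.indicator_of_mem hz]
        · simp only [Set.indicator_of_notMem hz, mul_zero]
      rw [c, c]
      rw [integral_prod_symm _ i1, integral_prod_symm _ i2]
      congr 1
      ext t
      by_cases ht : t ∈ A
      · simp only [Set.indicator, Set.mem_preimage, ht, if_true]
        rw [integral_mul_const]
        change p t * (q t / p t) = _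
        rw [mul_div_cancel₀ _ (hp t).ne']
        simp only [q, mul_comm]
      · simp [Set.indicator, ht]
    · exact (hhm.comp (comap_measurable _)).aestronglyMeasurable
  filter_upwards [main] with ω hω
  rw [← hω, hrhs]
end
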